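/- Let n ≥ 3, let b ∈ (0, (√(2n(n−2)+4) − 2)/(n(n−2))] and let a be defined by 2a = 2b + (n−2)b². Then for every curvature operator R ∈ S²_B(so(n)) whose Ricci tensor is positive semidefinite, the operator D_{a,b}(R) is positive semidefinite. -/

import Mathlib

/-!
Common setup: we identify ⋀²ℝⁿ with the Lie algebra `so n` of real skew-symmetric
`n × n` matrices, sending `eᵢ ∧ eⱼ` to the rotation by `π/2` in the plane spanned by
`eᵢ, eⱼ`; the inner product on `so n` is `⟪A, B⟫ = -(1/2)·tr (A * B)`, and under this
identification `v ∧ w` corresponds to the skew-symmetric matrix `v wᵀ - w vᵀ`, while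
the wedge `A ∧ B` of two endomorphisms of `ℝⁿ` acts on a skew matrix `M` by
`M ↦ (1/2)(A M Bᵀ + B M Aᵀ)` (the unique linear extension of
`v∧w ↦ (1/2)(Av ∧ Bw + Bv ∧ Aw)`).
-/

noncomputable section

namespace BW

open Matrix

abbrev Mat (n : ℕ) := Matrix (Fin n) (Fin n) ℝ

/-- `so n`: the space of real skew-symmetric `n × n` matrices (≅ ⋀²ℝⁿ). -/
def so (n : ℕ) : Submodule ℝ (Mat n) where
  carrier := {A | Aᵀ = -A}
  add_mem' := by
    intro A B hA hB
    simp only [Set.mem_setOf_eq] at *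
    rw [Matrix.transpose_add, hA, hB, neg_add]
  zero_mem' := by simp
  smul_mem' := by
    intro c A hA
    simp only [Set.mem_setOf_eq] at *
    rw [Matrix.transpose_smul, hA, smul_neg]

variable {n : ℕ}

lemma mem_so_iff {A : Mat n} : A ∈ so n ↔ Aᵀ = -A := Iff.rfl

/-- The inner product `⟨A,B⟩ = -(1/2)·tr(AB)` on `so n`. -/
def ip (A B : so n) : ℝ := -(1/2) * Matrix.trace ((A : Mat n) * (B : Mat n))

/-- `ip` as a linear map in the second variable. -/
def ipL (A : so n) : so n →ₗ[ℝ] ℝ where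
  toFun B := ip A B
  map_add' B C := by
    simp only [ip, Submodule.coe_add, Matrix.mul_add, Matrix.trace_add]; ring
  map_smul' c B := by
    simp only [ip, SetLike.val_smul, Matrix.mul_smul, Matrix.trace_smul, smul_eq_mul,
      RingHom.id_apply]; ring

/-- The Lie bracket (matrix commutator) on `so n`. -/
def brk (A B : so n) : so n :=
  ⟨(A : Mat n) * (B : Mat n) - (B : Mat n) * (A : Mat n), by
    have hA : (A : Mat n)ᵀ = -(A : Mat n) := A.2
    have hB : (B : Mat n)ᵀ = -(B : Mat n) := B.2
    rw [mem_so_iff, Matrix.transpose_sub, Matrix.transpose_mul, Matrix.transpose_mul, hA, hB]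
    noncomm_ring⟩

/-- Auxiliary linear map underlying `A ∧ B`. -/
def wedgeAux (A B : Mat n) : Mat n →ₗ[ℝ] Mat n where
  toFun M := (1/2 : ℝ) • (A * M * Bᵀ + B * M * Aᵀ)
  map_add' M N := by
    simp only [mul_add, add_mul, smul_add]
    module
  map_smul' c M := by
    simp only [mul_smul_comm, smul_mul_assoc, RingHom.id_apply]
    module

lemma wedgeAux_mem (A B : Mat n) : ∀ M ∈ so n, wedgeAux A B M ∈ so n := by
  intro M hM
  rw [mem_so_iff] at hM ⊢
  show ((1/2 : ℝ) • (A * M * Bᵀ + B * M * Aᵀ))ᵀ = -((1/2 : ℝ) • (A * M * Bᵀ + B * M * Aᵀ))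
  rw [Matrix.transpose_smul, Matrix.transpose_add, Matrix.transpose_mul, Matrix.transpose_mul,
    Matrix.transpose_mul, Matrix.transpose_mul, Matrix.transpose_transpose,
    Matrix.transpose_transpose, hM]
  simp only [Matrix.neg_mul, Matrix.mul_neg, Matrix.mul_assoc, smul_neg, neg_add, smul_add]
  abel

/-- The wedge `A ∧ B` of two endomorphisms of ℝⁿ, as an endomorphism of `so n ≅ ⋀²ℝⁿ`:
the unique linear map with `(A ∧ B)(v ∧ w) = (1/2)(Av ∧ Bw + Bv ∧ Aw)`. -/
def wedge (A B : Mat n) : Module.End ℝ (so n) :=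
  (wedgeAux A B).restrict (p := so n) (q := so n) (wedgeAux_mem A B)

/-- The index set of pairs `i < j`. -/
def pairs (n : ℕ) : Finset (Fin n × Fin n) := Finset.univ.filter fun p => p.1 < p.2

/-- The standard basis vector `eᵢ` of ℝⁿ. -/
def evec (i : Fin n) : Fin n → ℝ := fun k => if k = i then 1 else 0

/-- `v ∧ w`, as an element of `so n ≅ ⋀²ℝⁿ`. -/
def vwedge (v w : Fin n → ℝ) : so n :=
  ⟨Matrix.of fun i j => v i * w j - w i * v j, by
    rw [mem_so_iff]
    ext i j
    simp only [Matrix.transpose_apply, Matrix.of_apply, Matrix.neg_apply]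
    ring⟩

/-- The orthonormal basis vector `eᵢ ∧ eⱼ` of `so n ≅ ⋀²ℝⁿ`. -/
def bvec (i j : Fin n) : so n := vwedge (evec i) (evec j)

/-- Hamilton's sharp product `R # S`: the self-adjoint endomorphism of `so n` determined by
`⟨(R#S)h, h⟩ = (1/2)·Σ_{α,β} ⟨[R(b_α), S(b_β)], h⟩·⟨[b_α, b_β], h⟩`,
where `(b_α)` is the orthonormal basis `(eᵢ ∧ eⱼ)_{i<j}` of `so n`. -/
def sharp (R S : Module.End ℝ (so n)) : Module.End ℝ (so n) :=
  (1/4 : ℝ) • ∑ p ∈ pairs n, ∑ q ∈ pairs n,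
    ((ipL (brk (R (bvec p.1 p.2)) (S (bvec q.1 q.2)))).smulRight
        (brk (bvec p.1 p.2) (bvec q.1 q.2))
      + (ipL (brk (bvec p.1 p.2) (bvec q.1 q.2))).smulRight
        (brk (R (bvec p.1 p.2)) (S (bvec q.1 q.2))))

/-- The right-hand side `R² + R^#` of Hamilton's ODE. -/
def Qode (R : Module.End ℝ (so n)) : Module.End ℝ (so n) := R * R + sharp R R

/-- The coordinates `R_{ijkl} = ⟨R(eᵢ∧eⱼ), e_k∧e_l⟩` of an endomorphism of `so n`. -/
def Rcoord (R : Module.End ℝ (so n)) (i j k l : Fin n) : ℝ := ip (R (bvec i j)) (bvec k l)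

/-- Self-adjointness with respect to the inner product `ip`. -/
def selfAdjEnd (R : Module.End ℝ (so n)) : Prop := ∀ X Y : so n, ip (R X) Y = ip X (R Y)

/-- A curvature operator: a self-adjoint endomorphism of `so n ≅ ⋀²ℝⁿ` satisfying the
first Bianchi identity.  (`isCurvOp` carves out `S²_B(so n)`.) -/
def isCurvOp (R : Module.End ℝ (so n)) : Prop :=
  selfAdjEnd R ∧
    ∀ i j k l : Fin n, Rcoord R i j k l + Rcoord R j k i l + Rcoord R k i j l = 0

/-- The Ricci tensor `Ric_{ij} = Σ_k R_{ikjk}` of `R`. -/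
def RicM (R : Module.End ℝ (so n)) : Mat n := Matrix.of fun i j => ∑ k, Rcoord R i k j k

/-- `λ̄ = tr(Ric)/n`. -/
def lamb (R : Module.End ℝ (so n)) : ℝ := Matrix.trace (RicM R) / (n : ℝ)

/-- The traceless Ricci tensor `Ric₀ = Ric - (tr Ric / n)·id`. -/
def Ric0 (R : Module.End ℝ (so n)) : Mat n := RicM R - lamb R • (1 : Mat n)

/-- `σ = tr(Ric₀²)/n`. -/
def sigmaR (R : Module.End ℝ (so n)) : ℝ := Matrix.trace (Ric0 R * Ric0 R) / (n : ℝ)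

/-- `R_I = (λ̄/(n-1))·(id ∧ id)`, the projection of `R` onto `⟨I⟩`. -/
def RI (R : Module.End ℝ (so n)) : Module.End ℝ (so n) :=
  (lamb R / ((n : ℝ) - 1)) • wedge (1 : Mat n) (1 : Mat n)

/-- `R_{Ric₀} = (2/(n-2))·(Ric₀ ∧ id)`, the projection of `R` onto `⟨Ric₀⟩`. -/
def RRic0 (R : Module.End ℝ (so n)) : Module.End ℝ (so n) :=
  (2 / ((n : ℝ) - 2)) • wedge (Ric0 R) (1 : Mat n)

/-- The linear map `ℓ_{a,b}(R) = R + 2(n-1)a·R_I + (n-2)b·R_{Ric₀}`. -/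
def lab (a b : ℝ) (R : Module.End ℝ (so n)) : Module.End ℝ (so n) :=
  R + (2 * ((n : ℝ) - 1) * a) • RI R + (((n : ℝ) - 2) * b) • RRic0 R

/-- Positive semidefiniteness of the quadratic form of an endomorphism of `so n`. -/
def posSemidefEnd (R : Module.End ℝ (so n)) : Prop := ∀ X : so n, 0 ≤ ip (R X) X

/-- Positive definiteness of the quadratic form of an endomorphism of `so n`. -/
def posDefEnd (R : Module.End ℝ (so n)) : Prop := ∀ X : so n, X ≠ 0 → 0 < ip (R X) X

/-- `R` is 2-nonnegative: the sum of its two smallest eigenvalues is nonnegative;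
equivalently (Ky Fan), `q_R(X) + q_R(Y) ≥ 0` for all orthonormal pairs `X, Y`. -/
def twoNonneg (R : Module.End ℝ (so n)) : Prop :=
  ∀ X Y : so n, ip X X = 1 → ip Y Y = 1 → ip X Y = 0 → 0 ≤ ip (R X) X + ip (R Y) Y

/-- The (Frobenius) norm of an endomorphism of `so n`, computed in the orthonormal
basis `(eᵢ ∧ eⱼ)_{i<j}`. -/
def endNorm (R : Module.End ℝ (so n)) : ℝ :=
  Real.sqrt (∑ p ∈ pairs n, ip (R (bvec p.1 p.2)) (R (bvec p.1 p.2)))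

/-- The tangent cone `T_R C`: the closure of `{t·(S - R) : S ∈ C, t ≥ 0}`. -/
def tangCone (C : Set (Module.End ℝ (so n))) (R : Module.End ℝ (so n)) :
    Set (Module.End ℝ (so n)) :=
  {X | ∀ ε > 0, ∃ S ∈ C, ∃ t : ℝ, 0 ≤ t ∧ endNorm (X - t • (S - R)) < ε}

/-- `C` is a closed subset of the space of endomorphisms of `so n`. -/
def isClosedSet (C : Set (Module.End ℝ (so n))) : Prop :=
  ∀ X, (∀ ε > 0, ∃ Y ∈ C, endNorm (X - Y) < ε) → X ∈ C

/-- The interior of `C` relative to the subspace `S²_B(so n)` of curvature operators. -/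
def interiorCurv (C : Set (Module.End ℝ (so n))) : Set (Module.End ℝ (so n)) :=
  {X | isCurvOp X ∧ ∃ ε > 0, ∀ Y, isCurvOp Y → endNorm (Y - X) < ε → Y ∈ C}

/-- Auxiliary linear map `M ↦ g M gᵀ` on matrices. -/
def conjAux (g : Mat n) : Mat n →ₗ[ℝ] Mat n where
  toFun M := g * M * gᵀ
  map_add' M N := by simp only [mul_add, add_mul]
  map_smul' c M := by simp only [mul_smul_comm, smul_mul_assoc, RingHom.id_apply]

/-- `⋀²g` : the action `M ↦ g M gᵀ` of `g` on `so n ≅ ⋀²ℝⁿ` (for `g` orthogonal this is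
the second exterior power of `g`). -/
def conjSo (g : Mat n) : Module.End ℝ (so n) :=
  (conjAux g).restrict (p := so n) (q := so n) (fun M hM => by
    rw [mem_so_iff] at hM ⊢
    show (g * M * gᵀ)ᵀ = -(g * M * gᵀ)
    rw [Matrix.transpose_mul, Matrix.transpose_mul, Matrix.transpose_transpose, hM]
    simp only [Matrix.neg_mul, Matrix.mul_neg, Matrix.mul_assoc])

/-- The action `g · R = (⋀²g) ∘ R ∘ (⋀²g)⁻¹` of an orthogonal matrix `g`
(whose inverse is `gᵀ`) on endomorphisms of `so n`. -/
def onAct (g : Mat n) (R : Module.End ℝ (so n)) : Module.End ℝ (so n) :=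
  conjSo g * R * conjSo gᵀ

/-- Two sets are at Hausdorff distance at most `ε` from each other. -/
def hdClose (A B : Set (Module.End ℝ (so n))) (ε : ℝ) : Prop :=
  (∀ X ∈ A, ∃ Y ∈ B, endNorm (X - Y) ≤ ε) ∧ ∀ Y ∈ B, ∃ X ∈ A, endNorm (X - Y) ≤ ε

/-- The truncation `C ∩ {‖R‖ ≤ 1}`. -/
def truncSet (C : Set (Module.End ℝ (so n))) : Set (Module.End ℝ (so n)) :=
  {R ∈ C | endNorm R ≤ 1}

/-- The entries of `M ∈ so n` are antisymmetric. -/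
lemma so_apply_swap (M : so n) (i j : Fin n) : (M : Mat n) j i = -(M : Mat n) i j := by
  have h := congrFun (congrFun (mem_so_iff.1 M.2) i) j
  simpa using h

lemma bvec_apply (i j k l : Fin n) : (bvec i j : Mat n) k l =
    (if k = i then 1 else 0) * (if l = j then 1 else 0)
      - (if k = j then 1 else 0) * (if l = i then 1 else 0) := rfl

lemma bvec_swap (i j : Fin n) : bvec j i = -bvec i j := by
  ext k l
  simp only [bvec_apply, NegMemClass.coe_neg, Matrix.neg_apply]
  ring

lemma bvec_self (i : Fin n) : bvec i i = 0 := by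
  ext k l
  simp [bvec_apply]

lemma ip_eq_sum (A B : so n) :
    ip A B = (1/2) * ∑ i, ∑ j, (A : Mat n) i j * (B : Mat n) i j := by
  simp only [ip, Matrix.trace, Matrix.diag_apply, Matrix.mul_apply, Finset.mul_sum]
  refine Finset.sum_congr rfl fun i _ => Finset.sum_congr rfl fun j _ => ?_
  rw [so_apply_swap B i j]
  ring

lemma ip_comm (A B : so n) : ip A B = ip B A := by
  simp only [ip_eq_sum, mul_comm]

lemma ip_add_left (A B C : so n) : ip (A + B) C = ip A C + ip B C := by
  rw [ip_comm, ip_comm A, ip_comm B]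
  exact (ipL C).map_add A B

lemma ip_smul_left (c : ℝ) (A B : so n) : ip (c • A) B = c * ip A B := by
  rw [ip_comm, ip_comm A]
  exact (ipL B).map_smul c A

lemma ip_neg_left (A B : so n) : ip (-A) B = -ip A B := by
  rw [ip_comm, ip_comm A]
  exact (ipL B).map_neg A

lemma ip_sum_left {ι : Type*} (s : Finset ι) (f : ι → so n) (B : so n) :
    ip (∑ x ∈ s, f x) B = ∑ x ∈ s, ip (f x) B := by
  rw [ip_comm]
  simp only [ip_comm _ B]
  exact map_sum (ipL B) f s

lemma ip_bvec (A : so n) (i j : Fin n) : ip A (bvec i j) = (A : Mat n) i j := by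
  rw [ip_eq_sum]
  simp only [bvec_apply, mul_sub, Finset.sum_sub_distrib, mul_ite, mul_one, mul_zero,
    Finset.sum_ite_eq', Finset.mem_univ, if_true]
  simp [so_apply_swap A i j]
  ring

lemma apply_bvec_apply (R : Module.End ℝ (so n)) (i j k l : Fin n) :
    (R (bvec i j) : Mat n) k l = Rcoord R i j k l := (ip_bvec _ _ _).symm

lemma so_eq_sum_bvec (M : so n) :
    M = (1/2 : ℝ) • ∑ i, ∑ j, (M : Mat n) i j • bvec i j := by
  ext k l
  simp only [Submodule.coe_smul, Submodule.coe_sum, Matrix.smul_apply, Matrix.sum_apply,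
    bvec_apply, mul_sub, Finset.sum_sub_distrib, smul_eq_mul, mul_ite, mul_one, mul_zero,
    Finset.sum_ite_eq, Finset.mem_univ, if_true, Finset.sum_const_zero, Finset.sum_ite_irrel]
  rw [so_apply_swap M k l]
  ring

lemma apply_apply (R : Module.End ℝ (so n)) (M : so n) (k l : Fin n) :
    (R M : Mat n) k l = (1/2) * ∑ i, ∑ j, (M : Mat n) i j * Rcoord R i j k l := by
  conv_lhs => rw [so_eq_sum_bvec M]
  simp only [map_smul, map_sum, Submodule.coe_smul, Submodule.coe_sum, Matrix.smul_apply,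
    Matrix.sum_apply, smul_eq_mul, apply_bvec_apply]

lemma Rcoord_swap_left (R : Module.End ℝ (so n)) (i j k l : Fin n) :
    Rcoord R j i k l = -Rcoord R i j k l := by
  rw [Rcoord, bvec_swap, map_neg, ip_neg_left, Rcoord]

lemma Rcoord_swap_right (R : Module.End ℝ (so n)) (i j k l : Fin n) :
    Rcoord R i j l k = -Rcoord R i j k l := by
  rw [← apply_bvec_apply, ← apply_bvec_apply, so_apply_swap]

lemma Rcoord_pair {R : Module.End ℝ (so n)} (hR : selfAdjEnd R) (i j k l : Fin n) :
    Rcoord R k l i j = Rcoord R i j k l := by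
  rw [Rcoord, hR, ip_comm, Rcoord]

lemma Rcoord_add (R S : Module.End ℝ (so n)) (i j k l : Fin n) :
    Rcoord (R + S) i j k l = Rcoord R i j k l + Rcoord S i j k l :=
  ip_add_left _ _ _

/-- A sum over the pairs `i < j` of a symmetric function vanishing on the diagonal. -/
lemma sum_pairs (f : Fin n → Fin n → ℝ) (hs : ∀ i j, f j i = f i j) (h0 : ∀ i, f i i = 0) :
    ∑ p ∈ pairs n, f p.1 p.2 = (1/2) * ∑ i, ∑ j, f i j := by
  have h1 : ∑ p ∈ pairs n, f p.1 p.2 = ∑ i, ∑ j, if i < j then f i j else 0 := by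
    rw [pairs, Finset.sum_filter, ← Finset.univ_product_univ, Finset.sum_product]
  have h2 : ∑ i, ∑ j, (if i < j then f i j else 0) = ∑ i, ∑ j, if j < i then f i j else 0 := by
    rw [Finset.sum_comm]
    simp only [hs]
  have h3 : ∑ i, ∑ j, f i j = (∑ i, ∑ j, if i < j then f i j else 0)
      + ∑ i, ∑ j, if j < i then f i j else 0 := by
    simp only [← Finset.sum_add_distrib]
    refine Finset.sum_congr rfl fun i _ => Finset.sum_congr rfl fun j _ => ?_
    rcases lt_trichotomy i j with h | h | h
    · simp [h, h.not_gt]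
    · simp [h, h0]
    · simp [h, h.not_gt]
  rw [h1, h3, ← h2]
  ring

lemma ip_brk (A B M : so n) :
    ip (brk A B) M = ∑ u, ∑ v, ∑ w, (A : Mat n) u w * (B : Mat n) w v * (M : Mat n) u v := by
  have h : ∑ u, ∑ v, ((B : Mat n) * (A : Mat n)) u v * (M : Mat n) u v
      = -∑ u, ∑ v, ((A : Mat n) * (B : Mat n)) u v * (M : Mat n) u v := by
    rw [Finset.sum_comm]
    simp only [← Finset.sum_neg_distrib, Matrix.mul_apply]
    refine Finset.sum_congr rfl fun u _ => Finset.sum_congr rfl fun v _ => ?_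
    rw [so_apply_swap M u v, mul_neg, neg_inj]
    congr 1
    refine Finset.sum_congr rfl fun w _ => ?_
    rw [so_apply_swap A u w, so_apply_swap B w v]
    ring
  rw [ip_eq_sum]
  simp only [brk, Matrix.sub_apply, sub_mul, Finset.sum_sub_distrib, h]
  simp only [Matrix.mul_apply, Finset.sum_mul]
  ring

lemma ip_brk_bvec (i j k l : Fin n) (N : so n) :
    ip (brk (bvec i j) (bvec k l)) N =
      (if j = k then (N : Mat n) i l else 0) - (if j = l then (N : Mat n) i k else 0)
      - (if i = k then (N : Mat n) j l else 0) + (if i = l then (N : Mat n) j k else 0) := by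
  rw [ip_brk]
  simp only [bvec_apply, mul_sub, sub_mul, Finset.sum_sub_distrib, mul_ite, ite_mul, mul_one,
    mul_zero, one_mul, zero_mul, Finset.sum_ite_eq', Finset.mem_univ, if_true,
    Finset.sum_const_zero, Finset.sum_ite_irrel]
  simp only [eq_comm]
  ring

lemma brk_neg_left (A B : so n) : brk (-A) B = -brk A B := by
  ext i j
  simp [brk]
  ring

lemma brk_neg_right (A B : so n) : brk A (-B) = -brk A B := by
  ext i j
  simp [brk]
  ring

lemma sum_mul_ip_brk_bvec (h : Fin n → Fin n → Fin n → Fin n → ℝ)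
    (h1 : ∀ i j k l, h j i k l = -h i j k l) (h2 : ∀ i j k l, h i j l k = -h i j k l) (N : so n) :
    ∑ i, ∑ j, ∑ k, ∑ l, h i j k l * ip (brk (bvec i j) (bvec k l)) N
      = 4 * ∑ i, ∑ j, ∑ l, h i j j l * (N : Mat n) i l := by
  have e1 : ∑ i, ∑ j, ∑ k, ∑ l, (if j = k then h i j k l * (N : Mat n) i l else 0)
      = ∑ i, ∑ j, ∑ l, h i j j l * (N : Mat n) i l := by
    simp only [Finset.sum_ite_irrel, Finset.sum_const_zero, Finset.sum_ite_eq, Finset.mem_univ,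
      if_true]
  have e2 : ∑ i, ∑ j, ∑ k, ∑ l, (if j = l then h i j k l * (N : Mat n) i k else 0)
      = -∑ i, ∑ j, ∑ l, h i j j l * (N : Mat n) i l := by
    simp only [Finset.sum_ite_eq, Finset.mem_univ, if_true, ← Finset.sum_neg_distrib,
      ← neg_mul, ← h2]
  have e3 : ∑ i, ∑ j, ∑ k, ∑ l, (if i = k then h i j k l * (N : Mat n) j l else 0)
      = -∑ i, ∑ j, ∑ l, h i j j l * (N : Mat n) i l := by
    rw [Finset.sum_comm]
    simp only [Finset.sum_ite_irrel, Finset.sum_const_zero, Finset.sum_ite_eq, Finset.mem_univ,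
      if_true, ← Finset.sum_neg_distrib, ← neg_mul, ← h1]
  have e4 : ∑ i, ∑ j, ∑ k, ∑ l, (if i = l then h i j k l * (N : Mat n) j k else 0)
      = ∑ i, ∑ j, ∑ l, h i j j l * (N : Mat n) i l := by
    rw [Finset.sum_comm]
    simp only [Finset.sum_ite_eq, Finset.mem_univ, if_true]
    refine Finset.sum_congr rfl fun i _ => Finset.sum_congr rfl fun j _ =>
      Finset.sum_congr rfl fun l _ => ?_
    rw [h1, h2, neg_neg]
  simp only [ip_brk_bvec, mul_add, mul_sub, Finset.sum_add_distrib, Finset.sum_sub_distrib,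
    mul_ite, mul_zero, e1, e2, e3, e4]
  ring

/-- The contraction `∑ R_{ijuw} S_{jlwv} M_{uv} N_{il}` computing the sharp product. -/
def sharpForm (R S : Module.End ℝ (so n)) (M N : so n) : ℝ :=
  ∑ i, ∑ j, ∑ l, ∑ u, ∑ v, ∑ w,
    Rcoord R i j u w * Rcoord S j l w v * ((M : Mat n) u v * (N : Mat n) i l)

lemma sum_ip_brk_mul (R S : Module.End ℝ (so n)) (M N : so n) :
    ∑ i, ∑ j, ∑ k, ∑ l, ip (brk (R (bvec i j)) (S (bvec k l))) M
      * ip (brk (bvec i j) (bvec k l)) N = 4 * sharpForm R S M N := by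
  rw [sum_mul_ip_brk_bvec (fun i j k l => ip (brk (R (bvec i j)) (S (bvec k l))) M)]
  · simp only [ip_brk, apply_bvec_apply, sharpForm, Finset.sum_mul, mul_assoc]
  · intro i j k l
    simp only [bvec_swap i j, map_neg, brk_neg_left, ip_neg_left]
  · intro i j k l
    simp only [bvec_swap k l, map_neg, brk_neg_right, ip_neg_left]

lemma brk_zero_left (A : so n) : brk 0 A = 0 := by
  ext i j
  simp [brk]

lemma brk_zero_right (A : so n) : brk A 0 = 0 := by
  ext i j
  simp [brk]

lemma ip_zero_left (A : so n) : ip 0 A = 0 := by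
  simp [ip]

lemma ip_sharp (R S : Module.End ℝ (so n)) (M N : so n) :
    ip (sharp R S M) N = (1/4) * (sharpForm R S M N + sharpForm R S N M) := by
  have key : ∀ M N : so n, ∑ p ∈ pairs n, ∑ q ∈ pairs n,
      ip (brk (R (bvec p.1 p.2)) (S (bvec q.1 q.2))) M
        * ip (brk (bvec p.1 p.2) (bvec q.1 q.2)) N = sharpForm R S M N := by
    intro M N
    have h1 : ∀ i j, ∑ q ∈ pairs n, ip (brk (R (bvec i j)) (S (bvec q.1 q.2))) M
        * ip (brk (bvec i j) (bvec q.1 q.2)) N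
        = (1/2) * ∑ k, ∑ l, ip (brk (R (bvec i j)) (S (bvec k l))) M
          * ip (brk (bvec i j) (bvec k l)) N := by
      intro i j
      refine sum_pairs (fun k l => ip (brk (R (bvec i j)) (S (bvec k l))) M
          * ip (brk (bvec i j) (bvec k l)) N) ?_ ?_
      · intro k l
        simp only [bvec_swap k l, map_neg, brk_neg_right, ip_neg_left, neg_mul_neg]
      · intro k
        simp only [bvec_self, brk_zero_right, ip_zero_left, mul_zero]
    simp only [h1]
    rw [sum_pairs (fun i j => (1/2) * ∑ k, ∑ l, ip (brk (R (bvec i j)) (S (bvec k l))) M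
          * ip (brk (bvec i j) (bvec k l)) N)]
    · simp only [← Finset.mul_sum, sum_ip_brk_mul]
      ring
    · intro i j
      simp only [bvec_swap i j, map_neg, brk_neg_left, ip_neg_left, neg_mul_neg]
    · intro i
      simp only [bvec_self, brk_zero_left, ip_zero_left, mul_zero, Finset.sum_const_zero]
  rw [← key M N, ← key N M]
  simp only [sharp, LinearMap.smul_apply, LinearMap.sum_apply, LinearMap.add_apply,
    LinearMap.smulRight_apply, ip_smul_left, ip_sum_left, ip_add_left, Finset.sum_add_distrib]
  simp only [ipL, LinearMap.coe_mk, AddHom.coe_mk]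
  congr 2
  simp only [mul_comm]

lemma sum_rev_three (f : Fin n → Fin n → Fin n → ℝ) :
    ∑ i, ∑ j, ∑ l, f i j l = ∑ i, ∑ j, ∑ l, f l j i := by
  rw [Finset.sum_comm]
  conv_rhs => rw [Finset.sum_comm]
  exact Finset.sum_congr rfl fun j _ => Finset.sum_comm

lemma sharpForm_comm (R S : Module.End ℝ (so n)) (M N : so n) :
    sharpForm R S M N = sharpForm S R M N := by
  simp only [sharpForm]
  rw [sum_rev_three]
  refine Finset.sum_congr rfl fun i _ => Finset.sum_congr rfl fun j _ =>
    Finset.sum_congr rfl fun l _ => ?_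
  rw [Finset.sum_comm]
  refine Finset.sum_congr rfl fun u _ => Finset.sum_congr rfl fun v _ =>
    Finset.sum_congr rfl fun w _ => ?_
  rw [Rcoord_swap_left R j l v w, Rcoord_swap_right R j l w v, Rcoord_swap_left S i j w u,
    Rcoord_swap_right S i j u w, so_apply_swap M u v, so_apply_swap N i l]
  ring

lemma sharpForm_add (R S T : Module.End ℝ (so n)) (M N : so n) :
    sharpForm R (S + T) M N = sharpForm R S M N + sharpForm R T M N := by
  simp only [sharpForm, Rcoord_add, mul_add, add_mul, Finset.sum_add_distrib]

/-- The contraction `(R * A)_{ij} = ∑ R_{ikjl} A_{kl}`. -/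
def contr (R : Module.End ℝ (so n)) (A : Mat n) : Mat n :=
  Matrix.of fun i j => ∑ k, ∑ l, Rcoord R i k j l * A k l

lemma wedge_one_apply (A : Mat n) (M : so n) :
    (wedge A 1 M : Mat n) = (1/2 : ℝ) • (A * M + M * Aᵀ) := by
  change (1/2 : ℝ) • (A * (M : Mat n) * (1 : Mat n)ᵀ + (1 : Mat n) * (M : Mat n) * Aᵀ) = _
  rw [Matrix.transpose_one, Matrix.mul_one, Matrix.one_mul]

lemma Rcoord_wedge_one (A : Mat n) (i j k l : Fin n) :
    Rcoord (wedge A 1) i j k l = (1/2) * ((if j = l then A k i else 0)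
      - (if i = l then A k j else 0) + (if i = k then A l j else 0)
      - (if j = k then A l i else 0)) := by
  rw [← apply_bvec_apply, wedge_one_apply]
  simp only [Matrix.smul_apply, Matrix.add_apply, Matrix.mul_apply, bvec_apply, smul_eq_mul,
    Matrix.transpose_apply, mul_sub, sub_mul, Finset.sum_sub_distrib, mul_ite, ite_mul, mul_one,
    mul_zero, one_mul, zero_mul, Finset.sum_ite_eq', Finset.mem_univ, if_true,
    Finset.sum_ite_irrel, Finset.sum_const_zero]
  simp only [eq_comm (a := k), eq_comm (a := l)]
  split_ifs <;> ring

lemma sum_pair_comm (f : Fin n → Fin n → Fin n → Fin n → ℝ) :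
    ∑ i, ∑ j, ∑ k, ∑ l, f i j k l = ∑ k, ∑ l, ∑ i, ∑ j, f i j k l := by
  have h : ∀ i, ∑ j, ∑ k, ∑ l, f i j k l = ∑ k, ∑ l, ∑ j, f i j k l := fun i => by
    rw [Finset.sum_comm]
    exact Finset.sum_congr rfl fun k _ => Finset.sum_comm
  simp only [h]
  rw [Finset.sum_comm]
  exact Finset.sum_congr rfl fun k _ => Finset.sum_comm

lemma symm_apply {P : Mat n} (hP : Pᵀ = P) (i j : Fin n) : P j i = P i j :=
  congrFun (congrFun hP i) j

lemma sum_Rcoord_mul_apply (R : Module.End ℝ (so n)) (M : so n) (B : Mat n) :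
    ∑ i, ∑ j, ∑ k, ∑ l, Rcoord R i j k l * ((M : Mat n) i j * B k l)
      = 2 * ∑ k, ∑ l, (R M : Mat n) k l * B k l := by
  simp only [apply_apply, Finset.sum_mul, Finset.mul_sum]
  rw [sum_pair_comm]
  refine Finset.sum_congr rfl fun k _ => Finset.sum_congr rfl fun l _ =>
    Finset.sum_congr rfl fun i _ => Finset.sum_congr rfl fun j _ => ?_
  ring

/-- A consequence of the first Bianchi identity. -/
lemma sum_Rcoord_bianchi {R : Module.End ℝ (so n)} (hR : isCurvOp R) (M : so n) (B : Mat n) :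
    ∑ i, ∑ j, ∑ k, ∑ l, Rcoord R i j k l * ((M : Mat n) k j * B i l)
      = ∑ k, ∑ l, (R M : Mat n) k l * B k l := by
  have e1 : ∑ i, ∑ j, ∑ k, ∑ l, Rcoord R i j k l * ((M : Mat n) k j * B i l)
      = -∑ i, ∑ j, ∑ k, ∑ l, Rcoord R i k j l * ((M : Mat n) k j * B i l) := by
    rw [← Finset.sum_neg_distrib]
    refine Finset.sum_congr rfl fun i _ => ?_
    rw [Finset.sum_comm]
    simp only [← Finset.sum_neg_distrib]
    refine Finset.sum_congr rfl fun j _ => Finset.sum_congr rfl fun k _ =>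
      Finset.sum_congr rfl fun l _ => ?_
    rw [so_apply_swap M k j]
    ring
  have e2 := sum_Rcoord_mul_apply R M B
  rw [sum_rev_three] at e2
  have e3 : ∑ i, ∑ j, ∑ k, ∑ l, Rcoord R i j k l * ((M : Mat n) k j * B i l)
      - ∑ i, ∑ j, ∑ k, ∑ l, Rcoord R i k j l * ((M : Mat n) k j * B i l)
      = ∑ i, ∑ j, ∑ k, ∑ l, Rcoord R k j i l * ((M : Mat n) k j * B i l) := by
    simp only [← Finset.sum_sub_distrib]
    refine Finset.sum_congr rfl fun i _ => Finset.sum_congr rfl fun j _ =>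
      Finset.sum_congr rfl fun k _ => Finset.sum_congr rfl fun l _ => ?_
    linear_combination ((M : Mat n) k j * B i l) * (hR.2 i j k l - Rcoord_swap_left R k j i l
      - Rcoord_swap_left R i k j l)
  linarith

lemma ip_apply_wedge_one (R : Module.End ℝ (so n)) {P : Mat n} (hP : Pᵀ = P) (M : so n) :
    2 * ip (R M) (wedge P 1 M)
      = ∑ k, ∑ l, (R M : Mat n) k l * ((M : Mat n) * P) k l := by
  have h : ∑ k, ∑ l, (R M : Mat n) k l * (P * (M : Mat n)) k l
      = ∑ k, ∑ l, (R M : Mat n) k l * ((M : Mat n) * P) k l := by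
    rw [Finset.sum_comm]
    refine Finset.sum_congr rfl fun k _ => Finset.sum_congr rfl fun l _ => ?_
    have e : (P * (M : Mat n)) l k = -((M : Mat n) * P) k l := by
      rw [← Matrix.transpose_apply (P * (M : Mat n)), Matrix.transpose_mul, hP, mem_so_iff.1 M.2,
        Matrix.neg_mul, Matrix.neg_apply]
    rw [e, so_apply_swap (R M)]
    ring
  rw [ip_eq_sum]
  simp only [wedge_one_apply, hP, Matrix.smul_apply, Matrix.add_apply, smul_eq_mul, mul_add,
    Finset.sum_add_distrib, mul_left_comm _ (1/2 : ℝ), ← Finset.mul_sum, h]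
  ring

lemma sharpForm_wedge_one {R : Module.End ℝ (so n)} (hR : isCurvOp R) {P : Mat n} (hP : Pᵀ = P)
    (M : so n) :
    sharpForm R (wedge P 1) M M = -(1/2) * (Matrix.trace (contr R P * ((M : Mat n) * (M : Mat n)))
      + Matrix.trace (RicM R * ((M : Mat n) * P * (M : Mat n)))) - 2 * ip (R M) (wedge P 1 M) := by
  have t1 : ∑ i, ∑ j, ∑ l, ∑ u, ∑ v, ∑ w, (if l = v then
      Rcoord R i j u w * P w j * ((M : Mat n) u v * (M : Mat n) i l) else 0)
      = -Matrix.trace (contr R P * ((M : Mat n) * (M : Mat n))) := by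
    simp only [Finset.sum_ite_irrel, Finset.sum_const_zero, Finset.sum_ite_eq, Finset.mem_univ,
      if_true]
    simp only [contr, Matrix.trace, Matrix.diag_apply, Matrix.mul_apply, Matrix.of_apply,
      Finset.sum_mul, Finset.mul_sum]
    rw [← Finset.sum_neg_distrib]
    refine Finset.sum_congr rfl fun i _ => ?_
    rw [sum_rev_three, ← Finset.sum_neg_distrib]
    refine Finset.sum_congr rfl fun u _ => ?_
    simp only [← Finset.sum_neg_distrib]
    refine Finset.sum_congr rfl fun l _ => Finset.sum_congr rfl fun j _ =>
      Finset.sum_congr rfl fun w _ => ?_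
    rw [so_apply_swap M i l, symm_apply hP j w]
    ring
  have t2 : ∑ i, ∑ j, ∑ l, ∑ u, ∑ v, ∑ w, (if j = v then
      Rcoord R i j u w * P w l * ((M : Mat n) u v * (M : Mat n) i l) else 0)
      = 2 * ip (R M) (wedge P 1 M) := by
    rw [ip_apply_wedge_one R hP, ← sum_Rcoord_bianchi hR]
    simp only [Finset.sum_ite_irrel, Finset.sum_const_zero, Finset.sum_ite_eq, Finset.mem_univ,
      if_true, Matrix.mul_apply, Finset.mul_sum]
    refine Finset.sum_congr rfl fun i _ => Finset.sum_congr rfl fun j _ => ?_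
    rw [Finset.sum_comm]
    refine Finset.sum_congr rfl fun u _ => ?_
    rw [Finset.sum_comm]
    refine Finset.sum_congr rfl fun w _ => Finset.sum_congr rfl fun l _ => ?_
    rw [symm_apply hP l w]
    ring
  have t3 : ∑ i, ∑ j, ∑ l, ∑ u, ∑ v, ∑ w, (if j = w then
      Rcoord R i j u w * P v l * ((M : Mat n) u v * (M : Mat n) i l) else 0)
      = -Matrix.trace (RicM R * ((M : Mat n) * P * (M : Mat n))) := by
    simp only [Finset.sum_ite_eq, Finset.mem_univ, if_true]
    simp only [RicM, Matrix.trace, Matrix.diag_apply, Matrix.mul_apply, Matrix.of_apply, Finset.sum_mul, Finset.mul_sum]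
    simp only [← Finset.sum_neg_distrib]
    refine Finset.sum_congr rfl fun i _ => ?_
    rw [sum_rev_three]
    refine Finset.sum_congr rfl fun u _ => Finset.sum_congr rfl fun l _ => ?_
    rw [Finset.sum_comm]
    refine Finset.sum_congr rfl fun v _ => Finset.sum_congr rfl fun j _ => ?_
    rw [so_apply_swap M i l]
    ring
  have t4 : ∑ i, ∑ j, ∑ l, ∑ u, ∑ v, ∑ w, (if l = w then
      Rcoord R i j u w * P v j * ((M : Mat n) u v * (M : Mat n) i l) else 0)
      = 2 * ip (R M) (wedge P 1 M) := by
    rw [ip_apply_wedge_one R hP, ← sum_Rcoord_bianchi hR]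
    simp only [Finset.sum_ite_eq, Finset.mem_univ, if_true, Matrix.mul_apply, Finset.mul_sum]
    rw [sum_pair_comm, Finset.sum_comm]
    refine Finset.sum_congr rfl fun u _ => Finset.sum_congr rfl fun l _ =>
      Finset.sum_congr rfl fun i _ => Finset.sum_congr rfl fun j _ =>
      Finset.sum_congr rfl fun v _ => ?_
    rw [Rcoord_pair hR.1]
    ring
  have h : sharpForm R (wedge P 1) M M = (1/2) * (
      (∑ i, ∑ j, ∑ l, ∑ u, ∑ v, ∑ w, (if l = v then
        Rcoord R i j u w * P w j * ((M : Mat n) u v * (M : Mat n) i l) else 0))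
      - (∑ i, ∑ j, ∑ l, ∑ u, ∑ v, ∑ w, (if j = v then
        Rcoord R i j u w * P w l * ((M : Mat n) u v * (M : Mat n) i l) else 0))
      + (∑ i, ∑ j, ∑ l, ∑ u, ∑ v, ∑ w, (if j = w then
        Rcoord R i j u w * P v l * ((M : Mat n) u v * (M : Mat n) i l) else 0))
      - ∑ i, ∑ j, ∑ l, ∑ u, ∑ v, ∑ w, (if l = w then
        Rcoord R i j u w * P v j * ((M : Mat n) u v * (M : Mat n) i l) else 0)) := by
    simp only [sharpForm, ← Finset.sum_add_distrib, ← Finset.sum_sub_distrib, Finset.mul_sum]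
    refine Finset.sum_congr rfl fun i _ => Finset.sum_congr rfl fun j _ =>
      Finset.sum_congr rfl fun l _ => Finset.sum_congr rfl fun u _ =>
      Finset.sum_congr rfl fun v _ => Finset.sum_congr rfl fun w _ => ?_
    rw [Rcoord_wedge_one]
    split_ifs <;> ring
  rw [h, t1, t2, t3, t4]
  ring

lemma contr_symm {R : Module.End ℝ (so n)} (hR : selfAdjEnd R) {A : Mat n} (hA : Aᵀ = A) :
    (contr R A)ᵀ = contr R A := by
  ext i j
  simp only [contr, Matrix.transpose_apply, Matrix.of_apply]
  rw [Finset.sum_comm]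
  refine Finset.sum_congr rfl fun k _ => Finset.sum_congr rfl fun l _ => ?_
  rw [Rcoord_pair hR, symm_apply hA]

lemma RicM_symm {R : Module.End ℝ (so n)} (hR : selfAdjEnd R) : (RicM R)ᵀ = RicM R := by
  ext i j
  simp only [RicM, Matrix.transpose_apply, Matrix.of_apply]
  exact Finset.sum_congr rfl fun k _ => Rcoord_pair hR _ _ _ _

lemma sum_Rcoord_mul_cyclic {R : Module.End ℝ (so n)} (hR : isCurvOp R) (x y : Fin n) :
    ∑ a, ∑ b, ∑ c, Rcoord R y a b c * Rcoord R x c a b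
      = -(1/2) * ∑ a, ∑ b, ∑ c, Rcoord R y a b c * Rcoord R x a b c := by
  have e1 : ∑ a, ∑ b, ∑ c, Rcoord R y a b c * Rcoord R x b c a
      = ∑ a, ∑ b, ∑ c, Rcoord R y a b c * Rcoord R x c a b := by
    refine Finset.sum_congr rfl fun a _ => ?_
    rw [Finset.sum_comm]
    refine Finset.sum_congr rfl fun b _ => Finset.sum_congr rfl fun c _ => ?_
    rw [Rcoord_swap_right R y a b c, Rcoord_swap_right R x c a b]
    ring
  have e2 : ∑ a, ∑ b, ∑ c, Rcoord R y a b c * Rcoord R x a b c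
      + ∑ a, ∑ b, ∑ c, Rcoord R y a b c * Rcoord R x b c a
      + ∑ a, ∑ b, ∑ c, Rcoord R y a b c * Rcoord R x c a b = 0 := by
    simp only [← Finset.sum_add_distrib]
    refine Finset.sum_eq_zero fun a _ => Finset.sum_eq_zero fun b _ =>
      Finset.sum_eq_zero fun c _ => ?_
    have h := hR.2 a b c x
    rw [← Rcoord_pair hR.1 a b c x, ← Rcoord_pair hR.1 b c a x, ← Rcoord_pair hR.1 c a b x,
      Rcoord_swap_left R x c,
      Rcoord_swap_left R x a, Rcoord_swap_left R x b] at h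
    linear_combination -Rcoord R y a b c * h
  linarith

lemma sum_sharpForm_bvec {R : Module.End ℝ (so n)} (hR : isCurvOp R) (x y : Fin n) :
    ∑ z, sharpForm R R (bvec x z) (bvec y z) = 2 * contr R (RicM R) y x
      - ∑ a, ∑ b, ∑ c, Rcoord R y a b c * Rcoord R x a b c := by
  have h1 : ∑ z, ∑ j, ∑ w, Rcoord R y j x w * Rcoord R j z w z = contr R (RicM R) y x := by
    simp only [contr, RicM, Matrix.of_apply, Finset.mul_sum]
    rw [Finset.sum_comm]
    exact Finset.sum_congr rfl fun j _ => Finset.sum_comm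
  have h2 : ∑ z, ∑ j, ∑ w, Rcoord R z j z w * Rcoord R j y w x = contr R (RicM R) y x := by
    rw [← h1]
    refine Finset.sum_congr rfl fun z _ => Finset.sum_congr rfl fun j _ =>
      Finset.sum_congr rfl fun w _ => ?_
    rw [Rcoord_swap_left R j z, Rcoord_swap_right R j z z w, Rcoord_swap_left R y j,
      Rcoord_swap_right R y j x w]
    ring
  have h3 : ∑ z, ∑ j, ∑ w, Rcoord R y j z w * Rcoord R j z w x
      = -∑ a, ∑ b, ∑ c, Rcoord R y a b c * Rcoord R x c a b := by
    rw [Finset.sum_comm]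
    simp only [← Finset.sum_neg_distrib]
    refine Finset.sum_congr rfl fun j _ => Finset.sum_congr rfl fun z _ =>
      Finset.sum_congr rfl fun w _ => ?_
    rw [Rcoord_swap_right R j z x w, Rcoord_pair hR.1 x w j z]
    ring
  have h4 : ∑ z, ∑ j, ∑ w, Rcoord R z j x w * Rcoord R j y w z
      = -∑ a, ∑ b, ∑ c, Rcoord R y a b c * Rcoord R x c a b := by
    rw [← h3]
    refine Finset.sum_congr rfl fun z _ => Finset.sum_congr rfl fun j _ =>
      Finset.sum_congr rfl fun w _ => ?_
    rw [Rcoord_swap_left R j z, Rcoord_swap_right R j z w x, Rcoord_swap_left R y j,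
      Rcoord_swap_right R y j z w]
    ring
  have h : ∑ z, sharpForm R R (bvec x z) (bvec y z)
      = ∑ z, ∑ j, ∑ w, Rcoord R y j x w * Rcoord R j z w z
        - ∑ z, ∑ j, ∑ w, Rcoord R z j x w * Rcoord R j y w z
        - ∑ z, ∑ j, ∑ w, Rcoord R y j z w * Rcoord R j z w x
        + ∑ z, ∑ j, ∑ w, Rcoord R z j z w * Rcoord R j y w x := by
    simp only [sharpForm, bvec_apply, mul_sub, Finset.sum_sub_distrib, mul_ite,
      mul_one, mul_zero, Finset.sum_ite_eq', Finset.mem_univ,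
      if_true, Finset.sum_ite_irrel, Finset.sum_const_zero]
    ring
  rw [h, h1, h2, h3, h4, sum_Rcoord_mul_cyclic hR]
  ring

/-- The Ricci tensor of `R² + R^#` is `R * Ric`. -/
lemma RicM_Qode {R : Module.End ℝ (so n)} (hR : isCurvOp R) :
    RicM (Qode R) = contr R (RicM R) := by
  ext x y
  have hs := symm_apply (contr_symm hR.1 (RicM_symm hR.1)) x y
  have h1 : ∀ k, Rcoord (Qode R) x k y k
      = (1/2) * (∑ b, ∑ c, Rcoord R y k b c * Rcoord R x k b c)
        + (1/4) * (sharpForm R R (bvec x k) (bvec y k)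
          + sharpForm R R (bvec y k) (bvec x k)) := by
    intro k
    rw [Qode, Rcoord_add, Rcoord, Rcoord, ip_sharp, Module.End.mul_apply, hR.1, ip_comm, ip_eq_sum]
    simp only [apply_bvec_apply]
  have h2 : ∑ a, ∑ b, ∑ c, Rcoord R x a b c * Rcoord R y a b c
      = ∑ a, ∑ b, ∑ c, Rcoord R y a b c * Rcoord R x a b c := by
    simp only [mul_comm]
  change ∑ k, Rcoord (Qode R) x k y k = _
  simp only [h1, Finset.sum_add_distrib, ← Finset.mul_sum]
  rw [sum_sharpForm_bvec hR, sum_sharpForm_bvec hR, hs, h2]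
  ring

open scoped MatrixOrder in
lemma trace_mul_nonneg {A B : Mat n} (hA : A.PosSemidef) (hB : B.PosSemidef) :
    0 ≤ Matrix.trace (A * B) := by
  obtain ⟨C, rfl⟩ := CStarAlgebra.nonneg_iff_eq_star_mul_self.mp hA.nonneg
  rw [Matrix.mul_assoc, Matrix.trace_mul_comm]
  exact (hB.mul_mul_conjTranspose_same C).trace_nonneg

lemma trace_mul_so_mul_so_nonpos {A : Mat n} (hA : A.PosSemidef) (M : so n) :
    Matrix.trace (A * ((M : Mat n) * A * (M : Mat n))) ≤ 0 := by
  have h := trace_mul_nonneg hA (hA.mul_mul_conjTranspose_same (M : Mat n))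
  rw [Matrix.conjTranspose_eq_transpose_of_trivial, mem_so_iff.1 M.2, Matrix.mul_neg,
    Matrix.mul_neg, Matrix.trace_neg] at h
  linarith

lemma trace_sq_mul_so_sq_nonpos {A : Mat n} (hA : Aᵀ = A) (M : so n) :
    Matrix.trace (A * A * ((M : Mat n) * (M : Mat n))) ≤ 0 := by
  have h := (Matrix.posSemidef_self_mul_conjTranspose (A * (M : Mat n))).trace_nonneg
  rw [Matrix.conjTranspose_eq_transpose_of_trivial, Matrix.transpose_mul, hA, mem_so_iff.1 M.2,
    Matrix.neg_mul, Matrix.mul_neg, Matrix.trace_neg, ← Matrix.mul_assoc, Matrix.trace_mul_comm,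
    Matrix.mul_assoc A, ← Matrix.mul_assoc A A] at h
  linarith

lemma trace_so_sq_nonpos (M : so n) : Matrix.trace ((M : Mat n) * (M : Mat n)) ≤ 0 := by
  simpa using trace_sq_mul_so_sq_nonpos Matrix.transpose_one M

lemma wedge_add_left (A B C : Mat n) : wedge (A + B) C = wedge A C + wedge B C := by
  ext M i j
  change ((1/2 : ℝ) • ((A + B) * (M : Mat n) * Cᵀ + C * (M : Mat n) * (A + B)ᵀ)) i j
    = ((1/2 : ℝ) • (A * (M : Mat n) * Cᵀ + C * (M : Mat n) * Aᵀ)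
      + (1/2 : ℝ) • (B * (M : Mat n) * Cᵀ + C * (M : Mat n) * Bᵀ)) i j
  rw [Matrix.transpose_add, ← smul_add]
  noncomm_ring

lemma wedge_smul_left (c : ℝ) (A C : Mat n) : wedge (c • A) C = c • wedge A C := by
  ext M i j
  change ((1/2 : ℝ) • ((c • A) * (M : Mat n) * Cᵀ + C * (M : Mat n) * (c • A)ᵀ)) i j
    = (c • (1/2 : ℝ) • (A * (M : Mat n) * Cᵀ + C * (M : Mat n) * Aᵀ)) i j
  rw [Matrix.transpose_smul, smul_comm c]
  simp

/-- `ℓ_{a,b}(R) = R + P ∧ id` with `P = 2aλ̄·id + 2b·Ric₀`. -/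
lemma lab_eq (hn : 3 ≤ n) (a b : ℝ) (R : Module.End ℝ (so n)) :
    lab a b R = R + wedge ((2 * a * lamb R) • (1 : Mat n) + (2 * b) • Ric0 R) 1 := by
  have hn' : (3 : ℝ) ≤ n := by exact_mod_cast hn
  have h1 : (n : ℝ) - 1 ≠ 0 := by linarith
  have h2 : (n : ℝ) - 2 ≠ 0 := by linarith
  rw [lab, RI, RRic0, wedge_add_left, wedge_smul_left, wedge_smul_left, smul_smul, smul_smul,
    add_assoc]
  congr 3
  · field_simp
  · field_simp

lemma selfAdjEnd_wedge_one {P : Mat n} (hP : Pᵀ = P) : selfAdjEnd (wedge P (1 : Mat n)) := by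
  intro X Y
  simp only [ip, wedge_one_apply, hP, Matrix.smul_mul, Matrix.mul_smul, Matrix.trace_smul,
    Matrix.add_mul, Matrix.mul_add, Matrix.trace_add]
  rw [Matrix.mul_assoc P, Matrix.trace_mul_comm P, Matrix.mul_assoc, Matrix.mul_assoc, add_comm]

lemma isCurvOp_wedge_one {P : Mat n} (hP : Pᵀ = P) : isCurvOp (wedge P (1 : Mat n)) := by
  refine ⟨selfAdjEnd_wedge_one hP, fun i j k l => ?_⟩
  simp only [Rcoord_wedge_one, eq_comm (a := j) (b := i), eq_comm (a := k) (b := i),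
    eq_comm (a := k) (b := j), symm_apply hP k i, symm_apply hP k j, symm_apply hP j i]
  ring

lemma isCurvOp_add {R S : Module.End ℝ (so n)} (hR : isCurvOp R) (hS : isCurvOp S) :
    isCurvOp (R + S) := by
  refine ⟨fun X Y => ?_, fun i j k l => ?_⟩
  · rw [LinearMap.add_apply, LinearMap.add_apply, ip_add_left, hR.1, hS.1, ip_comm X, ip_comm X,
      ip_comm X, ip_add_left]
  · simp only [Rcoord_add]
    linarith [hR.2 i j k l, hS.2 i j k l]

lemma contr_add_left (R S : Module.End ℝ (so n)) (A : Mat n) :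
    contr (R + S) A = contr R A + contr S A := by
  ext i j
  simp only [contr, Matrix.of_apply, Matrix.add_apply, Rcoord_add, add_mul, Finset.sum_add_distrib]

lemma contr_add_right (R : Module.End ℝ (so n)) (A B : Mat n) :
    contr R (A + B) = contr R A + contr R B := by
  ext i j
  simp only [contr, Matrix.of_apply, Matrix.add_apply, mul_add, Finset.sum_add_distrib]

lemma contr_smul_right (R : Module.End ℝ (so n)) (c : ℝ) (A : Mat n) :
    contr R (c • A) = c • contr R A := by
  ext i j
  simp only [contr, Matrix.of_apply, Matrix.smul_apply, smul_eq_mul, Finset.mul_sum,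
    mul_left_comm c]

lemma contr_one (R : Module.End ℝ (so n)) : contr R 1 = RicM R := by
  ext i j
  simp [contr, RicM, Matrix.one_apply]

lemma RicM_add (R S : Module.End ℝ (so n)) : RicM (R + S) = RicM R + RicM S := by
  simp only [← contr_one, contr_add_left]

lemma trace_contr (R : Module.End ℝ (so n)) (A : Mat n) :
    Matrix.trace (contr R A) = Matrix.trace (RicM R * Aᵀ) := by
  simp only [Matrix.trace, Matrix.diag_apply, contr, RicM, Matrix.of_apply, Matrix.mul_apply,
    Matrix.transpose_apply, Finset.sum_mul]
  rw [Finset.sum_comm]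
  refine Finset.sum_congr rfl fun k _ => ?_
  rw [Finset.sum_comm]
  refine Finset.sum_congr rfl fun l _ => Finset.sum_congr rfl fun i _ => ?_
  rw [Rcoord_swap_left, Rcoord_swap_right, neg_neg]

lemma contr_wedge_one {P A : Mat n} (hP : Pᵀ = P) (hA : Aᵀ = A) :
    contr (wedge P 1) A = (1/2 : ℝ) • (Matrix.trace A • P + Matrix.trace (P * A) • (1 : Mat n)
      - P * A - A * P) := by
  ext i j
  simp only [contr, Rcoord_wedge_one, Matrix.of_apply, Matrix.smul_apply, Matrix.add_apply,
    Matrix.sub_apply, smul_eq_mul, Matrix.trace, Matrix.diag_apply, Matrix.mul_apply,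
    Matrix.one_apply]
  simp only [mul_add, mul_sub, add_mul, sub_mul, mul_assoc, ite_mul, mul_ite, zero_mul, mul_zero,
    Finset.sum_add_distrib, Finset.sum_sub_distrib, Finset.sum_ite_irrel, Finset.sum_ite_eq,
    Finset.sum_ite_eq', Finset.sum_const_zero, Finset.mem_univ, if_true]
  have e1 : ∑ x, P j x * A x i = ∑ x, A i x * P x j :=
    Finset.sum_congr rfl fun x _ => by rw [symm_apply hP x j, symm_apply hA i x, mul_comm]
  have e2 : ∑ x, P x i * A j x = ∑ x, P i x * A x j :=
    Finset.sum_congr rfl fun x _ => by rw [symm_apply hP i x, symm_apply hA x j]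
  have e3 : ∑ x, ∑ y, P y x * A x y = ∑ x, ∑ y, P x y * A y x := Finset.sum_comm
  simp only [← Finset.mul_sum, e1, e2, e3, symm_apply hP i j]
  split_ifs <;> ring

lemma RicM_wedge_one (A : Mat n) : RicM (wedge A (1 : Mat n)) =
    (1/2 : ℝ) • (((n : ℝ) - 2) • Aᵀ + Matrix.trace A • (1 : Mat n)) := by
  ext i j
  simp only [RicM, Rcoord_wedge_one, Matrix.of_apply, Matrix.smul_apply, Matrix.add_apply,
    smul_eq_mul, Matrix.trace, Matrix.diag_apply, Matrix.one_apply, Matrix.transpose_apply]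
  simp [← Finset.mul_sum, Finset.sum_add_distrib, Finset.sum_sub_distrib]
  ring

lemma ip_wedge_one (A : Mat n) (M : so n) :
    ip (wedge A 1 M) M = -(1/2) * Matrix.trace (A * ((M : Mat n) * (M : Mat n))) := by
  have h : Matrix.trace ((M : Mat n) * Aᵀ * (M : Mat n))
      = Matrix.trace (A * ((M : Mat n) * (M : Mat n))) := by
    rw [← Matrix.trace_transpose]
    simp only [Matrix.transpose_mul, Matrix.transpose_transpose, mem_so_iff.1 M.2,
      Matrix.neg_mul, Matrix.mul_neg, neg_neg]
    rw [← Matrix.mul_assoc, Matrix.trace_mul_cycle, Matrix.trace_mul_comm]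
  rw [ip, wedge_one_apply, Matrix.smul_mul, Matrix.trace_smul, Matrix.add_mul, Matrix.trace_add,
    h, Matrix.mul_assoc, smul_eq_mul]
  ring

lemma ip_Qode {R : Module.End ℝ (so n)} (hR : selfAdjEnd R) (M : so n) :
    ip (Qode R M) M = ip (R M) (R M) + (1/2) * sharpForm R R M M := by
  rw [Qode, LinearMap.add_apply, ip_add_left, ip_sharp, Module.End.mul_apply, hR]
  ring

/-- Expansion of the quadratic form of `Qode` around `R` in the direction `P ∧ id`. -/
lemma ip_Qode_add_wedge_one {R : Module.End ℝ (so n)} (hR : isCurvOp R) {P : Mat n} (hP : Pᵀ = P)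
    (M : so n) :
    ip (Qode (R + wedge P 1) M) M = ip (Qode R M) M
      - (1/2) * (Matrix.trace (contr R P * ((M : Mat n) * (M : Mat n)))
        + Matrix.trace (RicM R * ((M : Mat n) * P * (M : Mat n))))
      - (1/4) * (Matrix.trace (contr (wedge P 1) P * ((M : Mat n) * (M : Mat n)))
        + Matrix.trace (RicM (wedge P 1) * ((M : Mat n) * P * (M : Mat n)))) := by
  have hU := isCurvOp_wedge_one hP
  have h1 := sharpForm_wedge_one hR hP M
  have h2 := sharpForm_wedge_one hU hP M
  have h3 := sharpForm_comm (wedge P 1) R M M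
  rw [ip_Qode (isCurvOp_add hR hU).1, ip_Qode hR.1, sharpForm_add, sharpForm_comm (R + _) R,
    sharpForm_comm (R + _) (wedge P 1), sharpForm_add, sharpForm_add, LinearMap.add_apply,
    ip_add_left, ip_comm (R M) (_ + _), ip_comm (wedge P 1 M) (_ + _), ip_add_left, ip_add_left,
    ip_comm (wedge P 1 M) (R M)]
  linarith

lemma trace_RicM (hn : 3 ≤ n) (R : Module.End ℝ (so n)) :
    Matrix.trace (RicM R) = n * lamb R := by
  have h : (n : ℝ) ≠ 0 := by
    have : n ≠ 0 := by lia
    exact_mod_cast this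
  rw [lamb]
  field_simp

lemma RicM_eq (R : Module.End ℝ (so n)) : RicM R = lamb R • (1 : Mat n) + Ric0 R := by
  rw [Ric0]
  abel

lemma trace_Ric0 (hn : 3 ≤ n) (R : Module.End ℝ (so n)) : Matrix.trace (Ric0 R) = 0 := by
  rw [Ric0, Matrix.trace_sub, Matrix.trace_smul, Matrix.trace_one, trace_RicM hn, Fintype.card_fin,
    smul_eq_mul]
  ring

lemma Ric0_symm {R : Module.End ℝ (so n)} (hR : selfAdjEnd R) : (Ric0 R)ᵀ = Ric0 R := by
  rw [Ric0, Matrix.transpose_sub, RicM_symm hR, Matrix.transpose_smul, Matrix.transpose_one]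

/-- `ℓ_{a,b}` scales the scalar part of the Ricci tensor and its traceless part. -/
lemma RicM_lab (hn : 3 ≤ n) (a b : ℝ) (R : Module.End ℝ (so n)) :
    RicM (lab a b R) = ((1 + 2 * ((n : ℝ) - 1) * a) * lamb R) • (1 : Mat n) + Ric0 R
      + (((n : ℝ) - 2) * b) • (Ric0 R)ᵀ := by
  rw [lab_eq hn, RicM_add, RicM_wedge_one, RicM_eq R]
  simp only [Matrix.transpose_add, Matrix.transpose_smul, Matrix.transpose_one, Matrix.trace_add,
    Matrix.trace_smul, Matrix.trace_one, trace_Ric0 hn, Fintype.card_fin, smul_eq_mul]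
  module

lemma trace_transpose_mul_so_sq (A : Mat n) (M : so n) :
    Matrix.trace (Aᵀ * ((M : Mat n) * (M : Mat n)))
      = Matrix.trace (A * ((M : Mat n) * (M : Mat n))) := by
  rw [← Matrix.trace_transpose]
  simp only [Matrix.transpose_mul, Matrix.transpose_transpose, mem_so_iff.1 M.2, neg_mul_neg]
  rw [Matrix.trace_mul_comm]

lemma isCurvOp_lab (hn : 3 ≤ n) (a b : ℝ) {R : Module.End ℝ (so n)} (hR : isCurvOp R) :
    isCurvOp (lab a b R) := by
  rw [lab_eq hn]
  refine isCurvOp_add hR (isCurvOp_wedge_one ?_)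
  simp [Ric0_symm hR.1]

/-- The Ricci tensor of `Qode (ℓ_{a,b} R)`. -/
lemma RicM_Qode_lab (hn : 3 ≤ n) (a b : ℝ) {R : Module.End ℝ (so n)} (hR : isCurvOp R) :
    RicM (Qode (lab a b R)) =
      ((1 + 2 * ((n : ℝ) - 1) * a) ^ 2 * lamb R ^ 2
        + (1 + ((n : ℝ) - 2) * b) * b * n * sigmaR R) • (1 : Mat n)
      + (1 + ((n : ℝ) - 2) * b) • (((1 + 2 * ((n : ℝ) - 1) * a) * lamb R - 2 * a * lamb R) • Ric0 R
        + contr R (Ric0 R) - (2 * b) • (Ric0 R * Ric0 R)) := by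
  have hn0 : (n : ℝ) ≠ 0 := by
    have : n ≠ 0 := by lia
    exact_mod_cast this
  have hE := Ric0_symm hR.1
  have hP : ((2 * a * lamb R) • (1 : Mat n) + (2 * b) • Ric0 R)ᵀ
      = (2 * a * lamb R) • (1 : Mat n) + (2 * b) • Ric0 R := by
    simp [hE]
  have hs : Matrix.trace (Ric0 R * Ric0 R) = n * sigmaR R := by
    rw [sigmaR]
    field_simp
  have hU : contr (lab a b R) (Ric0 R) = contr R (Ric0 R) + (b * n * sigmaR R) • (1 : Mat n)
      - (2 * a * lamb R) • Ric0 R - (2 * b) • (Ric0 R * Ric0 R) := by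
    rw [lab_eq hn, contr_add_left, contr_wedge_one hP hE]
    simp only [Matrix.add_mul, Matrix.mul_add, Matrix.smul_mul, Matrix.mul_smul, Matrix.one_mul,
      Matrix.mul_one, Matrix.trace_add, Matrix.trace_smul, trace_Ric0 hn, hs, smul_eq_mul]
    module
  rw [RicM_Qode (isCurvOp_lab hn a b hR), RicM_lab hn, hE, contr_add_right, contr_add_right,
    contr_smul_right, contr_smul_right, contr_one, hU, RicM_lab hn, hE]
  module

lemma lamb_of_lab_eq_Qode (hn : 3 ≤ n) {a b : ℝ} {R X : Module.End ℝ (so n)} (hR : isCurvOp R)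
    (hX : lab a b X = Qode (lab a b R)) :
    (1 + 2 * ((n : ℝ) - 1) * a) * lamb X
      = (1 + 2 * ((n : ℝ) - 1) * a) ^ 2 * lamb R ^ 2
        + (1 + ((n : ℝ) - 2) * b) ^ 2 * sigmaR R := by
  have hn0 : (n : ℝ) ≠ 0 := by
    have : n ≠ 0 := by lia
    exact_mod_cast this
  have hs : Matrix.trace (Ric0 R * Ric0 R) = n * sigmaR R := by
    rw [sigmaR]
    field_simp
  have hU : Matrix.trace (contr R (Ric0 R)) = n * sigmaR R := by
    rw [trace_contr, Ric0_symm hR.1, RicM_eq, Matrix.add_mul, Matrix.trace_add, hs]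
    simp [trace_Ric0 hn]
  have h := congrArg (fun Y => Matrix.trace (RicM Y)) hX
  simp only [RicM_lab hn a b X, RicM_Qode_lab hn a b hR, Matrix.trace_add, Matrix.trace_sub,
    Matrix.trace_smul, Matrix.trace_one, Matrix.trace_transpose, trace_Ric0 hn, hs, hU,
    Fintype.card_fin, smul_eq_mul] at h
  refine mul_right_cancel₀ hn0 ?_
  linear_combination h

lemma trace_Ric0_of_lab_eq_Qode (hn : 3 ≤ n) {a b : ℝ} (hb : 1 + ((n : ℝ) - 2) * b ≠ 0)
    {R X : Module.End ℝ (so n)} (hR : isCurvOp R)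
    (hX : lab a b X = Qode (lab a b R)) (M : so n) :
    Matrix.trace (Ric0 X * ((M : Mat n) * (M : Mat n)))
      = (1 + 2 * ((n : ℝ) - 1) * a) * lamb R
          * Matrix.trace (Ric0 R * ((M : Mat n) * (M : Mat n)))
        + Matrix.trace (contr R (Ric0 R) * ((M : Mat n) * (M : Mat n)))
        - 2 * a * lamb R * Matrix.trace (Ric0 R * ((M : Mat n) * (M : Mat n)))
        - 2 * b * Matrix.trace (Ric0 R * Ric0 R * ((M : Mat n) * (M : Mat n)))
        + (b * n - (1 + ((n : ℝ) - 2) * b)) * sigmaR R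
          * Matrix.trace ((M : Mat n) * (M : Mat n)) := by
  have h := congrArg (fun Y => Matrix.trace (RicM Y * ((M : Mat n) * (M : Mat n)))) hX
  simp only [RicM_lab hn a b X, RicM_Qode_lab hn a b hR, Matrix.add_mul, Matrix.sub_mul,
    Matrix.smul_mul, Matrix.one_mul, Matrix.trace_add, Matrix.trace_sub, Matrix.trace_smul,
    trace_transpose_mul_so_sq, smul_eq_mul] at h
  rw [lamb_of_lab_eq_Qode hn hR hX] at h
  refine mul_left_cancel₀ hb ?_
  linear_combination h

/-- The quadratic form of `D_{a,b}(R)` in terms of the Ricci tensor of `R`. -/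
lemma ip_sub_Qode_of_lab_eq_Qode (hn : 3 ≤ n) {a b : ℝ}
    (ha : 2 * a = 2 * b + ((n : ℝ) - 2) * b ^ 2) (hc : 1 + ((n : ℝ) - 2) * b ≠ 0)
    {R X : Module.End ℝ (so n)} (hR : isCurvOp R)
    (hX : lab a b X = Qode (lab a b R)) (M : so n) :
    (1 + 2 * ((n : ℝ) - 1) * a) * ip ((X - Qode R) M) M =
      (1 + 2 * ((n : ℝ) - 1) * a)
          * (-a * Matrix.trace (RicM R * ((M : Mat n) * RicM R * (M : Mat n)))
            - b ^ 2 * Matrix.trace (Ric0 R * Ric0 R * ((M : Mat n) * (M : Mat n))))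
        - (1/2) * (sigmaR R * b ^ 2 * (2 - 4 * b - (n : ℝ) * ((n : ℝ) - 2) * b ^ 2))
          * Matrix.trace ((M : Mat n) * (M : Mat n)) := by
  have hn0 : (n : ℝ) ≠ 0 := by
    have : n ≠ 0 := by lia
    exact_mod_cast this
  have hE := Ric0_symm hR.1
  have hs : Matrix.trace (Ric0 R * Ric0 R) = n * sigmaR R := by
    rw [sigmaR]
    field_simp
  have hP : ((2 * a * lamb R) • (1 : Mat n) + (2 * b) • Ric0 R)ᵀ
      = (2 * a * lamb R) • (1 : Mat n) + (2 * b) • Ric0 R := by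
    simp [hE]
  have hcyc : Matrix.trace ((M : Mat n) * Ric0 R * (M : Mat n))
      = Matrix.trace (Ric0 R * ((M : Mat n) * (M : Mat n))) := by
    rw [Matrix.mul_assoc, Matrix.trace_mul_comm, Matrix.mul_assoc]
  have h1 := congrArg (fun Y => ip (Y M) M) hX
  simp only [lab_eq hn a b] at h1
  rw [ip_Qode_add_wedge_one hR hP, LinearMap.add_apply, ip_add_left, ip_wedge_one,
    contr_wedge_one hP hP, RicM_wedge_one, hP] at h1
  simp only [contr_add_right, contr_smul_right, contr_one, RicM_eq R, Matrix.add_mul,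
    Matrix.sub_mul, Matrix.mul_add, Matrix.smul_mul, Matrix.mul_smul,
    Matrix.one_mul, Matrix.mul_one, Matrix.trace_add, Matrix.trace_sub, Matrix.trace_smul,
    Matrix.trace_one, smul_eq_mul, Fintype.card_fin, smul_add, trace_Ric0 hn, hs, hcyc] at h1
  have h2 := lamb_of_lab_eq_Qode hn hR hX
  have h3 := trace_Ric0_of_lab_eq_Qode hn hc hR hX M
  rw [h3] at h1
  have hD : ip ((X - Qode R) M) M = ip (X M) M - ip (Qode R M) M := by
    rw [LinearMap.sub_apply, sub_eq_add_neg (X M), ip_add_left, ip_neg_left, sub_eq_add_neg]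
  rw [hD]
  simp only [RicM_eq R, Matrix.add_mul, Matrix.mul_add, Matrix.smul_mul, Matrix.mul_smul,
    Matrix.one_mul, Matrix.mul_one, Matrix.trace_add, Matrix.trace_smul, smul_eq_mul, hcyc]
  have ha' : a = b + ((n : ℝ) - 2) * b ^ 2 / 2 := by linarith
  generalize Matrix.trace (contr R (Ric0 R) * ((M : Mat n) * (M : Mat n))) = y at *
  generalize Matrix.trace (Ric0 R * Ric0 R * ((M : Mat n) * (M : Mat n))) = x₂ at *
  generalize Matrix.trace (Ric0 R * ((M : Mat n) * (M : Mat n))) = x₁ at *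
  generalize Matrix.trace (Ric0 R * ((M : Mat n) * Ric0 R * (M : Mat n))) = w at *
  generalize Matrix.trace ((M : Mat n) * (M : Mat n)) = x₀ at *
  generalize ip (X M) M = q at *
  generalize ip (Qode R M) M = q' at *
  generalize lamb X = l at *
  generalize lamb R = l' at *
  generalize sigmaR R = s at *
  generalize (n : ℝ) = m at *
  clear hX hP hE hs hcyc h3 hD
  subst ha'
  linear_combination (1 + 2 * (m - 1) * (b + (m - 2) * b ^ 2 / 2)) * h1
    + (b + (m - 2) * b ^ 2 / 2) * x₀ * h2

/-- For `b` in the given range and `2a = 2b + (n−2)b²`, the operator `D_{a,b}(R)` is positive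
semidefinite whenever `R` is a curvature operator with positive semidefinite Ricci tensor
(written with `X = ℓ_{a,b}⁻¹((ℓ_{a,b}R)² + (ℓ_{a,b}R)^#)`,
i.e. `ℓ_{a,b} X = (ℓ_{a,b}R)² + (ℓ_{a,b}R)^#`). -/
theorem stmt_11 {n : ℕ} (hn : 3 ≤ n) (b : ℝ)
    (hb : b ∈ Set.Ioc 0
      ((Real.sqrt (2 * (n : ℝ) * ((n : ℝ) - 2) + 4) - 2) / ((n : ℝ) * ((n : ℝ) - 2))))
    (a : ℝ) (ha : 2 * a = 2 * b + ((n : ℝ) - 2) * b ^ 2)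
    (R : Module.End ℝ (so n)) (hR : isCurvOp R) (hric : (RicM R).PosSemidef)
    (X : Module.End ℝ (so n)) (hX : lab a b X = Qode (lab a b R)) :
    posSemidefEnd (X - Qode R) := by
  intro M
  obtain ⟨hb0, hb1⟩ := hb
  have hn' : (3 : ℝ) ≤ n := by exact_mod_cast hn
  have hk : 0 < (n : ℝ) * ((n : ℝ) - 2) := mul_pos (by linarith) (by linarith)
  have h2b : 0 ≤ ((n : ℝ) - 2) * b ^ 2 := mul_nonneg (by linarith) (sq_nonneg b)
  have ha0 : 0 < a := by linarith
  have hc₁ : 0 < 1 + 2 * ((n : ℝ) - 1) * a := by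
    have : 0 < 2 * ((n : ℝ) - 1) * a := mul_pos (by linarith) ha0
    linarith
  have hc₂ : 1 + ((n : ℝ) - 2) * b ≠ 0 := by
    have : 0 < ((n : ℝ) - 2) * b := mul_pos (by linarith) hb0
    linarith
  have hq : 0 ≤ 2 - 4 * b - (n : ℝ) * ((n : ℝ) - 2) * b ^ 2 := by
    rw [le_div_iff₀ hk] at hb1
    have hle : (n : ℝ) * ((n : ℝ) - 2) * b + 2 ≤ √(2 * (n : ℝ) * ((n : ℝ) - 2) + 4) := by
      linarith
    have h0 : 0 ≤ (n : ℝ) * ((n : ℝ) - 2) * b + 2 := by positivity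
    rw [Real.le_sqrt h0 (by linarith)] at hle
    refine nonneg_of_mul_nonneg_right ?_ hk
    linarith
  have hs : 0 ≤ sigmaR R := by
    have h := (Matrix.posSemidef_conjTranspose_mul_self (Ric0 R)).trace_nonneg
    rw [Matrix.conjTranspose_eq_transpose_of_trivial, Ric0_symm hR.1] at h
    exact div_nonneg h (by linarith)
  have h₁ := mul_nonneg ha0.le (neg_nonneg.2 (trace_mul_so_mul_so_nonpos hric M))
  have h₂ := mul_nonneg (sq_nonneg b)
    (neg_nonneg.2 (trace_sq_mul_so_sq_nonpos (Ric0_symm hR.1) M))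
  have h₃ := mul_nonneg (mul_nonneg (mul_nonneg hs (sq_nonneg b)) hq)
    (neg_nonneg.2 (trace_so_sq_nonpos M))
  refine nonneg_of_mul_nonneg_right ?_ hc₁
  rw [ip_sub_Qode_of_lab_eq_Qode hn ha hc₂ hR hX M]
  have h₁₂ := mul_nonneg hc₁.le (add_nonneg h₁ h₂)
  linarith

end BW
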